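/- arXiv:2007.07733 — 7 statements merged into one kernel-verified Lean document; each statement's English description precedes it below -/
import Mathlib

section
/- Let v, α, r_d, c1, c3, c4 be strictly positive real constants and define g(r) = -tanh(α(r - r_d)/c4) + v/(c1·c3·r) for r > 0. Then g has exactly one root r_e in (0, ∞), and this root satisfies r_e > r_d. Consequently, for any s_d ∈ ℝ, the equilibrium concentration s_e = s_d - α(r_e - r_d) satisfies s_e < s_d. -/
open Real

theorem Real.tanh_strictMono : StrictMono Real.tanh := fun x y hxy =>
  (artanh_lt_artanh_iff ⟨neg_one_lt_tanh x, tanh_lt_one x⟩ ⟨neg_one_lt_tanh y, tanh_lt_one y⟩).1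
    (by simpa only [artanh_tanh] using hxy)

theorem Real.continuous_tanh : Continuous Real.tanh := by
  have h : Real.tanh = fun x => Real.sinh x / Real.cosh x := funext Real.tanh_eq_sinh_div_cosh
  rw [h]
  exact continuous_sinh.div continuous_cosh fun x => (cosh_pos x).ne'

theorem strictAntiOn_neg_tanh_add_div {v α rd k c : ℝ} (hv : 0 < v) (hα : 0 < α) (hk : 0 < k)
    (hc : 0 < c) :
    StrictAntiOn (fun r => -Real.tanh (α * (r - rd) / c) + v / (k * r)) (Set.Ioi 0) := by
  intro x hx y _ hxy
  have hx' : 0 < x := hx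
  have htanh : Real.tanh (α * (x - rd) / c) < Real.tanh (α * (y - rd) / c) :=
    Real.tanh_strictMono (by gcongr)
  have hdiv : v / (k * y) < v / (k * x) := by gcongr
  dsimp only
  linarith

theorem exists_neg_tanh_add_div_eq_zero {v α rd k c : ℝ} (hv : 0 < v) (hα : 0 < α) (hrd : 0 < rd)
    (hk : 0 < k) (hc : 0 < c) :
    ∃ r, rd < r ∧ -Real.tanh (α * (r - rd) / c) + v / (k * r) = 0 := by
  have ha : 0 < artanh (1 / 2) := artanh_pos ⟨by norm_num, by norm_num⟩
  have hta : Real.tanh (artanh (1 / 2)) = 1 / 2 := tanh_artanh ⟨by norm_num, by norm_num⟩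
  obtain ⟨R, hR⟩ : ∃ R, R = rd + c * artanh (1 / 2) / α + 2 * v / k := ⟨_, rfl⟩
  have hp : 0 < c * artanh (1 / 2) / α := by positivity
  have hq : 0 < 2 * v / k := by positivity
  have hrdR : rd ≤ R := by linarith
  have hcont : ContinuousOn (fun r => -Real.tanh (α * (r - rd) / c) + v / (k * r))
      (Set.Icc rd R) := by
    refine ((Real.continuous_tanh.comp (by fun_prop)).neg.continuousOn).add
      (continuousOn_const.div (by fun_prop) fun r hr => ?_)
    exact (mul_pos hk (hrd.trans_le hr.1)).ne'
  have htanh : 1 / 2 ≤ Real.tanh (α * (R - rd) / c) := by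
    rw [← hta]
    refine Real.tanh_strictMono.monotone ?_
    calc artanh (1 / 2) = α * (c * artanh (1 / 2) / α) / c := by field_simp
      _ ≤ α * (R - rd) / c := by gcongr; linarith
  have hdiv : v / (k * R) ≤ 1 / 2 := by
    have hle : 2 * v / k ≤ R := by linarith
    rw [div_le_iff₀ hk] at hle
    rw [div_le_iff₀ (mul_pos hk (hrd.trans_le hrdR))]
    linarith
  have hleft : 0 < -Real.tanh (α * (rd - rd) / c) + v / (k * rd) := by
    simp only [sub_self, mul_zero, zero_div, Real.tanh_zero, neg_zero, zero_add]
    positivity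
  obtain ⟨r, hr, hr0⟩ := intermediate_value_Icc' hrdR hcont (show (0 : ℝ) ∈ Set.Icc _ _ from
    ⟨by linarith, hleft.le⟩)
  refine ⟨r, hr.1.lt_of_ne ?_, hr0⟩
  rintro rfl
  exact hleft.ne' hr0

/-- The function `g(r) = -tanh(α(r - r_d)/c4) + v/(c1 c3 r)` has exactly one root
`r_e` in `(0, ∞)`, this root satisfies `r_e > r_d`, and the equilibrium concentration
`s_e = s_d - α(r_e - r_d)` satisfies `s_e < s_d` for every `s_d`. -/
theorem stmt_0 (v α rd c1 c3 c4 : ℝ)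
    (hv : 0 < v) (hα : 0 < α) (hrd : 0 < rd) (hc1 : 0 < c1) (hc3 : 0 < c3) (hc4 : 0 < c4) :
    ∃ re : ℝ, (0 < re ∧ -Real.tanh (α * (re - rd) / c4) + v / (c1 * c3 * re) = 0) ∧
      (∀ r : ℝ, 0 < r → -Real.tanh (α * (r - rd) / c4) + v / (c1 * c3 * r) = 0 → r = re) ∧
      rd < re ∧
      ∀ sd : ℝ, sd - α * (re - rd) < sd := by
  have hk : 0 < c1 * c3 := mul_pos hc1 hc3
  obtain ⟨re, hlt, hre⟩ := exists_neg_tanh_add_div_eq_zero hv hα hrd hk hc4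
  have hpos : 0 < re := hrd.trans hlt
  refine ⟨re, ⟨hpos, hre⟩, fun r hr h => ?_, hlt, fun sd => ?_⟩
  · exact (strictAntiOn_neg_tanh_add_div hv hα hk hc4).injOn hr hpos (h.trans hre.symm)
  · exact sub_lt_self sd (mul_pos hα (sub_pos.2 hlt))
end

section
/- Let v, α, r_d, c3, c4 be strictly positive real constants. For each c1 > 0 let r_e(c1) denote the unique root in (0, ∞) of g_{c1}(r) = -tanh(α(r - r_d)/c4) + v/(c1·c3·r). Then the map c1 ↦ r_e(c1) is strictly decreasing on (0, ∞) and r_e(c1) → r_d as c1 → ∞; equivalently, the steady-state error s_d - s_e(c1) = α(r_e(c1) - r_d) is strictly decreasing in c1 and tends to 0 as c1 → ∞. -/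
open Real Filter

theorem Real.tanh_lt_tanh_of_lt {x y : ℝ} (h : x < y) : Real.tanh x < Real.tanh y := by
  rw [Real.tanh_eq_sinh_div_cosh, Real.tanh_eq_sinh_div_cosh,
    div_lt_div_iff₀ (Real.cosh_pos x) (Real.cosh_pos y)]
  have hpos : 0 < Real.sinh (y - x) := Real.sinh_pos_iff.mpr (sub_pos.mpr h)
  rw [Real.sinh_sub] at hpos
  linarith

/-- For each `c1 > 0`, let `r_e(c1)` be the unique positive root of
`g_{c1}(r) = -tanh(α(r - r_d)/c4) + v/(c1 c3 r)`. Then `c1 ↦ r_e(c1)` is strictly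
decreasing on `(0, ∞)` and tends to `r_d` as `c1 → ∞`; equivalently the steady-state
error `s_d - s_e(c1) = α(r_e(c1) - r_d)` is strictly decreasing and tends to `0`. -/
theorem stmt_1 (v α rd c3 c4 : ℝ)
    (hv : 0 < v) (hα : 0 < α) (hrd : 0 < rd) (hc3 : 0 < c3) (hc4 : 0 < c4)
    (re : ℝ → ℝ)
    (hre : ∀ c1 : ℝ, 0 < c1 →
      (0 < re c1 ∧ -Real.tanh (α * (re c1 - rd) / c4) + v / (c1 * c3 * re c1) = 0) ∧
      ∀ r : ℝ, 0 < r → -Real.tanh (α * (r - rd) / c4) + v / (c1 * c3 * r) = 0 → r = re c1) :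
    StrictAntiOn re (Set.Ioi (0 : ℝ)) ∧
    Tendsto re atTop (nhds rd) ∧
    StrictAntiOn (fun c1 => α * (re c1 - rd)) (Set.Ioi (0 : ℝ)) ∧
    Tendsto (fun c1 => α * (re c1 - rd)) atTop (nhds 0) := by
  have hmono : StrictMono fun r : ℝ => Real.tanh (α * (r - rd) / c4) := fun r s h =>
    Real.tanh_lt_tanh_of_lt (by gcongr)
  have hpos : ∀ c1, 0 < c1 → 0 < re c1 := fun c1 h => (hre c1 h).1.1
  have heq : ∀ c1, 0 < c1 → Real.tanh (α * (re c1 - rd) / c4) = v / (c1 * c3 * re c1) :=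
    fun c1 h => by linarith [(hre c1 h).1.2]
  have hlower : ∀ c1, 0 < c1 → rd < re c1 := by
    intro c1 h
    have := hpos c1 h
    refine hmono.lt_iff_lt.mp ?_
    simp only [sub_self, mul_zero, zero_div, Real.tanh_zero, heq c1 h]
    positivity
  have hanti : StrictAntiOn re (Set.Ioi (0 : ℝ)) := by
    intro a ha b hb hab
    rw [Set.mem_Ioi] at ha hb
    by_contra! hle
    have h₁ := hmono.monotone hle
    simp only [heq a ha, heq b hb] at h₁
    have := hpos a ha
    have h₂ : v / (b * c3 * re b) < v / (a * c3 * re a) := by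
      apply div_lt_div_of_pos_left hv (by positivity)
      calc a * c3 * re a < b * c3 * re a := by gcongr
        _ ≤ b * c3 * re b := by gcongr
    exact h₁.not_gt h₂
  have hlim : Tendsto re atTop (nhds rd) := by
    refine tendsto_order.mpr ⟨fun r hr => ?_, fun r hr => ?_⟩
    · filter_upwards [eventually_gt_atTop 0] with c1 h
      exact hr.trans (hlower c1 h)
    · have hT : 0 < Real.tanh (α * (r - rd) / c4) := by
        simpa using hmono hr
      filter_upwards [eventually_gt_atTop 0,
        eventually_gt_atTop (v / (c3 * rd * Real.tanh (α * (r - rd) / c4)))] with c1 h hc1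
      refine hmono.lt_iff_lt.mp ?_
      have hlt := hlower c1 h
      simp only [heq c1 h]
      rw [div_lt_iff₀ (by positivity)] at hc1
      calc v / (c1 * c3 * re c1) ≤ v / (c1 * c3 * rd) := by gcongr
        _ < Real.tanh (α * (r - rd) / c4) := by
          rw [div_lt_iff₀ (by positivity)]
          linarith
  refine ⟨hanti, hlim, fun a ha b hb hab => ?_, ?_⟩
  · exact mul_lt_mul_of_pos_left (sub_lt_sub_right (hanti ha hb hab) rd) hα
  · simpa using (hlim.sub_const rd).const_mul α
end

section
/- Let k, b be real constants with k > b > 0 and let z : [t0, ∞) → ℝ be a differentiable function satisfying ż(t) = -k·tanh(z(t)) + b for all t ≥ t0. Then limsup_{t→∞} |z(t)| ≤ arctanh(b/k). -/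
open Real Filter

/-- The inverse hyperbolic tangent, `arctanh x = (1/2) log((1+x)/(1-x))`,
well-defined on `(-1, 1)`. -/
noncomputable def arctanh (x : ℝ) : ℝ := (1 / 2) * Real.log ((1 + x) / (1 - x))

/-- If `w` is the equilibrium of `ż = -k tanh z + b`, then `y = sinh (z - w)` solves the
linear equation `ẏ = -(k - b tanh z) y`. -/
theorem hasDerivAt_sinh_sub_equilibrium {k b w t : ℝ} {z : ℝ → ℝ} (hw : k * tanh w = b)
    (hz : HasDerivAt z (-k * tanh (z t) + b) t) :
    HasDerivAt (fun s => sinh (z s - w)) (-(k - b * tanh (z t)) * sinh (z t - w)) t := by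
  convert (hz.sub_const w).sinh using 1
  have hc := (cosh_pos w).ne'
  have hC := (cosh_pos (z t)).ne'
  rw [tanh_eq_sinh_div_cosh] at hw
  subst hw
  rw [tanh_eq_sinh_div_cosh, sinh_sub, cosh_sub]
  field_simp
  ring

/-- If `ẏ = -g y` with `g` bounded below by a positive constant, then `y` tends to zero. -/
theorem tendsto_zero_of_hasDerivAt_neg_mul {c t₀ : ℝ} {y g : ℝ → ℝ} (hc : 0 < c)
    (hg : ∀ t, t₀ ≤ t → c ≤ g t) (hy : ∀ t, t₀ ≤ t → HasDerivAt y (-g t * y t) t) :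
    Tendsto y atTop (nhds 0) := by
  have hd : ∀ t, t₀ ≤ t → HasDerivAt (fun s => y s ^ 2 * exp (2 * c * s))
      (2 * (c - g t) * y t ^ 2 * exp (2 * c * t)) t := by
    intro t ht
    refine (((hy t ht).fun_pow 2).fun_mul
      ((hasDerivAt_id' t).const_mul (2 * c)).exp).congr_deriv ?_
    push_cast
    ring
  have hanti : AntitoneOn (fun s => y s ^ 2 * exp (2 * c * s)) (Set.Ici t₀) := by
    refine antitoneOn_of_deriv_nonpos (convex_Ici t₀)
      (fun t ht => (hd t ht).continuousAt.continuousWithinAt)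
      (fun t ht => (hd t (interior_subset ht)).differentiableAt.differentiableWithinAt) ?_
    intro t ht
    have ht' : t₀ ≤ t := interior_subset ht
    rw [(hd t ht').deriv]
    refine mul_nonpos_of_nonpos_of_nonneg (mul_nonpos_of_nonpos_of_nonneg ?_ (sq_nonneg _))
      (exp_pos _).le
    linarith [hg t ht']
  have hexp : Tendsto (fun t => y t₀ ^ 2 * exp (2 * c * t₀) * exp (-(2 * c * t))) atTop
      (nhds 0) := by
    have h := tendsto_exp_neg_atTop_nhds_zero.comp
      (tendsto_id.const_mul_atTop (by positivity : (0 : ℝ) < 2 * c))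
    simpa using h.const_mul (y t₀ ^ 2 * exp (2 * c * t₀))
  have hsq : Tendsto (fun t => y t ^ 2) atTop (nhds 0) := by
    refine squeeze_zero' (Eventually.of_forall fun t => sq_nonneg _) ?_ hexp
    filter_upwards [eventually_ge_atTop t₀] with t ht
    rw [exp_neg, ← div_eq_mul_inv, le_div_iff₀ (exp_pos _)]
    exact hanti Set.self_mem_Ici ht ht
  rw [tendsto_zero_iff_abs_tendsto_zero]
  simpa [Function.comp_def, sqrt_sq_eq_abs] using hsq.sqrt

/-- Solutions of `ż = -k tanh z + b` with `0 < b < k` converge to the equilibrium. -/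
theorem tendsto_of_hasDerivAt_neg_mul_tanh_add {k b t₀ w : ℝ} {z : ℝ → ℝ} (hb : 0 < b)
    (hk : b < k) (hw : k * tanh w = b)
    (hz : ∀ t, t₀ ≤ t → HasDerivAt z (-k * tanh (z t) + b) t) :
    Tendsto z atTop (nhds w) := by
  have h := tendsto_zero_of_hasDerivAt_neg_mul (sub_pos.2 hk)
    (fun t _ => by nlinarith [tanh_lt_one (z t)])
    (fun t ht => hasDerivAt_sinh_sub_equilibrium hw (hz t ht))
  have h' := (continuous_arsinh.tendsto 0).comp h
  simpa [Function.comp_def] using h'.add_const w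

/-- If `k > b > 0` and `ż(t) = -k tanh(z(t)) + b` for all `t ≥ t0`, then
`limsup_{t→∞} |z(t)| ≤ arctanh(b/k)`. -/
theorem stmt_5 (k b t0 : ℝ) (hb : 0 < b) (hk : b < k)
    (z : ℝ → ℝ)
    (hz : ∀ t : ℝ, t0 ≤ t → HasDerivAt z (-k * Real.tanh (z t) + b) t) :
    limsup (fun t => |z t|) atTop ≤ arctanh (b / k) := by
  have hk0 : 0 < k := hb.trans hk
  have h0 : 0 < b / k := div_pos hb hk0
  have h1 : b / k < 1 := (div_lt_one hk0).2 hk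
  have heq : arctanh (b / k) = artanh (b / k) :=
    (artanh_eq_half_log ⟨by linarith, h1.le⟩).symm
  have hw : k * tanh (artanh (b / k)) = b := by
    rw [tanh_artanh ⟨by linarith, h1⟩, mul_div_cancel₀ _ hk0.ne']
  have h := (tendsto_of_hasDerivAt_neg_mul_tanh_add hb hk hw hz).abs
  rw [h.limsup_eq, heq, abs_of_pos (artanh_pos ⟨h0, h1⟩)]
end

section
/- Let F : ℝ² → ℝ be twice continuously differentiable, and fix constants v, c1, c3, c4 > 0, s_d ∈ ℝ, t0 ∈ ℝ. Let (p, θ) : [t0, ∞) → ℝ² × ℝ be differentiable and satisfy the Dubins closed loop ṗ(t) = v(cos θ(t), sin θ(t)), θ̇(t) = c1( (d/dt)F(p(t)) + c3 tanh((F(p(t)) - s_d)/c4) ). Let (p1, ζ) : [t0, ∞) → ℝ² × ℝ be differentiable and satisfy the single-integrator closed loop ṗ1(t) = v(cos θ1(t), sin θ1(t)) with θ1(t) = c1·F(p1(t)) + c1·c3·ζ(t) and ζ̇(t) = tanh((F(p1(t)) - s_d)/c4). If p(t0) = p1(t0) and θ(t0) = θ1(t0), then p(t) = p1(t) and θ(t)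 = θ1(t) for all t ≥ t0. -/
open Real

open Set in
/-- Two solutions on `[t₀, ∞)` of an autonomous ODE with locally Lipschitz vector field that agree
at `t₀` agree for all later times. -/
theorem LocallyLipschitz.eq_of_hasDerivAt_of_le {E : Type*} [NormedAddCommGroup E]
    [NormedSpace ℝ E] {V : E → E} (hV : LocallyLipschitz V) {f g : ℝ → E} {t₀ : ℝ}
    (hf : ∀ t, t₀ ≤ t → HasDerivAt f (V (f t)) t)
    (hg : ∀ t, t₀ ≤ t → HasDerivAt g (V (g t)) t)
    (h₀ : f t₀ = g t₀) {t : ℝ} (ht : t₀ ≤ t) : f t = g t := by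
  have hfc : ContinuousOn f (Icc t₀ t) := HasDerivAt.continuousOn fun x hx => hf x hx.1
  have hgc : ContinuousOn g (Icc t₀ t) := HasDerivAt.continuousOn fun x hx => hg x hx.1
  have hcomp : IsCompact (f '' Icc t₀ t ∪ g '' Icc t₀ t) :=
    (isCompact_Icc.image_of_continuousOn hfc).union (isCompact_Icc.image_of_continuousOn hgc)
  obtain ⟨K, hK⟩ := hV.locallyLipschitzOn.exists_lipschitzOnWith_of_compact hcomp
  exact ODE_solution_unique_of_mem_Icc_right (v := fun _ => V) (fun _ _ => hK)
    hfc (fun x hx => (hf x hx.1).hasDerivWithinAt)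
    (fun x hx => Or.inl (mem_image_of_mem f (Ico_subset_Icc_self hx)))
    hgc (fun x hx => (hg x hx.1).hasDerivWithinAt)
    (fun x hx => Or.inr (mem_image_of_mem g (Ico_subset_Icc_self hx)))
    h₀ (right_mem_Icc.2 ht)

theorem Real.contDiff_tanh {n : WithTop ℕ∞} : ContDiff ℝ n Real.tanh := by
  rw [show Real.tanh = fun x => Real.sinh x / Real.cosh x from
    funext Real.tanh_eq_sinh_div_cosh]
  exact Real.contDiff_sinh.div Real.contDiff_cosh fun x => (Real.cosh_pos x).ne'

/-- Trajectory identity of a Dubins vehicle under the P-like controller and a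
single-integrator vehicle under the concentration-only controller: if the two
vehicles start at the same initial state, their trajectories coincide. -/
theorem stmt_6 (F : ℝ × ℝ → ℝ) (hF : ContDiff ℝ 2 F)
    (v c1 c3 c4 sd t0 : ℝ)
    (hv : 0 < v) (hc1 : 0 < c1) (hc3 : 0 < c3) (hc4 : 0 < c4)
    -- Dubins vehicle under the P-like controller
    (p : ℝ → ℝ × ℝ) (θ : ℝ → ℝ) (ds : ℝ → ℝ)
    (hp : ∀ t : ℝ, t0 ≤ t →
      HasDerivAt p (v * Real.cos (θ t), v * Real.sin (θ t)) t)
    (hds : ∀ t : ℝ, t0 ≤ t → HasDerivAt (fun τ => F (p τ)) (ds t) t)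
    (hθ : ∀ t : ℝ, t0 ≤ t →
      HasDerivAt θ (c1 * (ds t + c3 * Real.tanh ((F (p t) - sd) / c4))) t)
    -- single-integrator vehicle under the concentration-only controller
    (p1 : ℝ → ℝ × ℝ) (ζ : ℝ → ℝ) (θ1 : ℝ → ℝ)
    (hθ1 : ∀ t : ℝ, θ1 t = c1 * F (p1 t) + c1 * c3 * ζ t)
    (hp1 : ∀ t : ℝ, t0 ≤ t →
      HasDerivAt p1 (v * Real.cos (θ1 t), v * Real.sin (θ1 t)) t)
    (hζ : ∀ t : ℝ, t0 ≤ t →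
      HasDerivAt ζ (Real.tanh ((F (p1 t) - sd) / c4)) t)
    -- identical initial states
    (hinit : p t0 = p1 t0 ∧ θ t0 = θ1 t0) :
    ∀ t : ℝ, t0 ≤ t → p t = p1 t ∧ θ t = θ1 t := by
  have hV : ContDiff ℝ 1 fun x : (ℝ × ℝ) × ℝ =>
      ((v * Real.cos (c1 * F x.1 + x.2), v * Real.sin (c1 * F x.1 + x.2)),
        c1 * c3 * Real.tanh ((F x.1 - sd) / c4)) := by
    have hF1 : ContDiff ℝ 1 fun x : (ℝ × ℝ) × ℝ => F x.1 :=
      (hF.of_le one_le_two).comp contDiff_fst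
    have hphase : ContDiff ℝ 1 fun x : (ℝ × ℝ) × ℝ => c1 * F x.1 + x.2 :=
      (contDiff_const.mul hF1).add contDiff_snd
    exact ((contDiff_const.mul hphase.cos).prodMk (contDiff_const.mul hphase.sin)).prodMk
      (contDiff_const.mul (Real.contDiff_tanh.comp ((hF1.sub contDiff_const).div_const c4)))
  have hdubins : ∀ t, t0 ≤ t → HasDerivAt (fun t => (p t, θ t - c1 * F (p t)))
      ((v * Real.cos (c1 * F (p t) + (θ t - c1 * F (p t))),
        v * Real.sin (c1 * F (p t) + (θ t - c1 * F (p t)))),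
        c1 * c3 * Real.tanh ((F (p t) - sd) / c4)) t := by
    intro t ht
    rw [add_sub_cancel]
    refine (hp t ht).prodMk (((hθ t ht).sub ((hds t ht).const_mul c1)).congr_deriv ?_)
    ring
  have hintegrator : ∀ t, t0 ≤ t → HasDerivAt (fun t => (p1 t, c1 * c3 * ζ t))
      ((v * Real.cos (c1 * F (p1 t) + c1 * c3 * ζ t),
        v * Real.sin (c1 * F (p1 t) + c1 * c3 * ζ t)),
        c1 * c3 * Real.tanh ((F (p1 t) - sd) / c4)) t := by
    intro t ht
    rw [← hθ1]
    exact (hp1 t ht).prodMk ((hζ t ht).const_mul (c1 * c3))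
  intro t ht
  have h := hV.locallyLipschitz.eq_of_hasDerivAt_of_le hdubins hintegrator
    (by simp [hinit.1, hinit.2, hθ1]) ht
  obtain ⟨hpos, hphase⟩ := Prod.mk.inj h
  refine ⟨hpos, ?_⟩
  rw [hθ1, ← hphase, hpos]
  ring
end

section
/- Fix constants v, α, r_d, c4 > 0, c1 > 0, 0 < c3 < αv, s_d ∈ ℝ, and t0 ∈ ℝ. Let r, φ : [t0, ∞) → ℝ be differentiable with r(t) > 0 for all t ≥ t0, satisfying ṙ(t) = v cos φ(t) and φ̇(t) = c1(-αv cos φ(t) - c3 tanh(α(r(t) - r_d)/c4)) - (v/r(t)) sin φ(t) for all t ≥ t0. If φ(t0) ∈ [-π, 0], then φ(t) ∈ [-π, 0] for all t ≥ t0, i.e., the interval [-π, 0] is positively invariant for the heading angle φ. -/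
open Real

/-- A differentiable function on `[t₀, ∞)` whose derivative is negative wherever it takes the
value `c` cannot cross `c` upwards. -/
theorem le_const_of_deriv_neg_of_eq {f f' : ℝ → ℝ} {t₀ c : ℝ}
    (hf : ∀ t, t₀ ≤ t → HasDerivAt f (f' t) t) (h₀ : f t₀ ≤ c)
    (hneg : ∀ t, t₀ ≤ t → f t = c → f' t < 0) {t : ℝ} (ht : t₀ ≤ t) : f t ≤ c :=
  image_le_of_deriv_right_lt_deriv_boundary (B := fun _ => c) (B' := fun _ => 0)
    (fun x hx => (hf x hx.1).continuousAt.continuousWithinAt)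
    (fun x hx => (hf x hx.1).hasDerivWithinAt) h₀ (fun x => hasDerivAt_const x c)
    (fun x hx => hneg x hx.1) (Set.right_mem_Icc.2 ht)

/-- Positive invariance of the heading region `[-π, 0]` for the P-like controller
in a circular field: if `φ(t0) ∈ [-π, 0]`, then `φ(t) ∈ [-π, 0]` for all `t ≥ t0`. -/
theorem stmt_12 (v α rd c1 c3 c4 sd t0 : ℝ)
    (hv : 0 < v) (hα : 0 < α) (hrd : 0 < rd) (hc4 : 0 < c4) (hc1 : 0 < c1)
    (hc3 : 0 < c3) (hc3' : c3 < α * v)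
    (r φ : ℝ → ℝ)
    (hrpos : ∀ t : ℝ, t0 ≤ t → 0 < r t)
    (hφ0 : φ t0 ∈ Set.Icc (-π) 0)
    (hdr : ∀ t : ℝ, t0 ≤ t → HasDerivAt r (v * Real.cos (φ t)) t)
    (hdφ : ∀ t : ℝ, t0 ≤ t → HasDerivAt φ
      (c1 * (-(α * v) * Real.cos (φ t) - c3 * Real.tanh (α * (r t - rd) / c4))
        - (v / r t) * Real.sin (φ t)) t) :
    ∀ t : ℝ, t0 ≤ t → φ t ∈ Set.Icc (-π) 0 := by
  have gain (x : ℝ) : |c3 * Real.tanh x| < α * v := by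
    rw [abs_mul, abs_of_pos hc3]
    exact (mul_le_of_le_one_right hc3.le (abs_tanh_lt_one x).le).trans_lt hc3'
  intro t ht
  constructor
  · refine neg_le_neg_iff.1 (le_const_of_deriv_neg_of_eq (f := fun t => -φ t) (c := -(-π))
      (fun s hs => (hdφ s hs).fun_neg) (neg_le_neg hφ0.1) (fun s _ h => ?_) ht)
    have h_eq : φ s = -π := neg_injective h
    have hb := (abs_lt.1 (gain (α * (r s - rd) / c4))).2
    simp only [h_eq, cos_neg, cos_pi, sin_neg, sin_pi]
    nlinarith [mul_pos hc1 (sub_pos.2 hb)]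
  · refine le_const_of_deriv_neg_of_eq hdφ hφ0.2 (fun s _ h => ?_) ht
    have hb := (abs_lt.1 (gain (α * (r s - rd) / c4))).1
    simp only [h, cos_zero, sin_zero]
    nlinarith [mul_pos hc1 (sub_pos.2 hb)]
end

section
/- Fix constants v, c3, c4, γ1, γ2, γ3 > 0, ε ∈ (0, π/2), s_d ∈ ℝ, t0 ∈ ℝ, with c3 < v·γ1·cos ε and c1 > γ3·v / (γ1·sin ε·(v·γ1·cos ε - c3)). Let s : [t0, ∞) → ℝ be twice differentiable, let φ : [t0, ∞) → ℝ be continuous, and let n, q : [t0, ∞) → ℝ satisfy γ1 ≤ n(t) ≤ γ2 and |q(t)| ≤ γ3 for all t. Assume that for all t ≥ t0: ṡ(t) = -v·n(t)·cos φ(t), s̈(t) = ω(t)·v·n(t)·sin φ(t) + v²·q(t) with ω(t) = c1(ṡ(t) + c3 tanh((s(t) - s_d)/c4)), and φ(t) ∈ [-π + ε, -ε]. Then, with e(t) = ṡ(t) + c3 tanh((s(t) - s_d)/c4), limsup_{t→∞} |e(t)| ≤ (γ3·v + c3·γ2/c4) / (c1·γ1·sin ε). -/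
open Real Filter

/-- A differential inequality `x * x' ≤ -a x² + a b |x|` forces `limsup |x| ≤ b`. -/
theorem limsup_abs_le_of_mul_deriv_le {a b t0 : ℝ} (ha : 0 < a) (hb : 0 ≤ b) {x x' : ℝ → ℝ}
    (hx : ∀ t, t0 ≤ t → HasDerivAt x (x' t) t)
    (hle : ∀ t, t0 ≤ t → x t * x' t ≤ -a * x t ^ 2 + a * b * |x t|) :
    limsup (fun t => |x t|) atTop ≤ b := by
  set g : ℝ → ℝ := fun t => exp (a * t) * (x t ^ 2 - b ^ 2) with hg
  have hgd : ∀ t, t0 ≤ t → HasDerivAt g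
      (exp (a * t) * a * (x t ^ 2 - b ^ 2) + exp (a * t) * (2 * x t * x' t)) t := by
    intro t ht
    have h1 : HasDerivAt (fun t => exp (a * t)) (exp (a * t) * a) t := by
      simpa using ((hasDerivAt_id t).const_mul a).exp
    have h2 : HasDerivAt (fun t => x t ^ 2 - b ^ 2) (2 * x t * x' t) t := by
      simpa using ((hx t ht).pow 2).sub_const (b ^ 2)
    exact h1.mul h2
  have hanti : AntitoneOn g (Set.Ici t0) := by
    refine antitoneOn_of_deriv_nonpos (convex_Ici t0)
      (fun t ht => (hgd t ht).continuousAt.continuousWithinAt) ?_ ?_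
    · intro t ht
      exact (hgd t (interior_subset ht)).differentiableAt.differentiableWithinAt
    · intro t ht
      have ht : t0 ≤ t := interior_subset ht
      rw [(hgd t ht).deriv]
      have h1 := hle t ht
      have h2 : 0 ≤ a * (|x t| - b) ^ 2 := by positivity
      have h3 : a * (x t ^ 2 - b ^ 2) + 2 * x t * x' t ≤ 0 := by
        nlinarith [sq_abs (x t)]
      nlinarith [exp_pos (a * t)]
  have hbound : ∀ t, t0 ≤ t → |x t| ≤ √(b ^ 2 + exp (-(a * t)) * g t0) := by
    intro t ht
    refine Real.abs_le_sqrt ?_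
    have h1 : exp (-(a * t)) * g t ≤ exp (-(a * t)) * g t0 :=
      mul_le_mul_of_nonneg_left (hanti (Set.mem_Ici.2 le_rfl) (Set.mem_Ici.2 ht) ht)
        (exp_pos _).le
    have h2 : exp (-(a * t)) * g t = x t ^ 2 - b ^ 2 := by
      rw [hg, ← mul_assoc, ← exp_add]
      simp
    linarith
  have hlim : Tendsto (fun t => √(b ^ 2 + exp (-(a * t)) * g t0)) atTop (nhds b) := by
    have h1 : Tendsto (fun t => exp (-(a * t))) atTop (nhds 0) :=
      tendsto_exp_neg_atTop_nhds_zero.comp (tendsto_id.const_mul_atTop ha)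
    have h2 := ((h1.mul_const (g t0)).const_add (b ^ 2)).sqrt
    simpa [Real.sqrt_sq hb] using h2
  rw [← hlim.limsup_eq]
  refine limsup_le_limsup ?_ ?_ hlim.isBoundedUnder_le
  · filter_upwards [eventually_ge_atTop t0] with t ht using hbound t ht
  · exact isCoboundedUnder_le_of_le atTop (x := 0) fun t => abs_nonneg _

theorem hasDerivAt_real_tanh (x : ℝ) : HasDerivAt Real.tanh (1 - Real.tanh x ^ 2) x := by
  have hc := (Real.cosh_pos x).ne'
  have h := (Real.hasDerivAt_sinh x).div (Real.hasDerivAt_cosh x) hc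
  have he : Real.tanh = Real.sinh / Real.cosh := funext Real.tanh_eq_sinh_div_cosh
  have hd : 1 - Real.tanh x ^ 2 =
      (Real.cosh x * Real.cosh x - Real.sinh x * Real.sinh x) / Real.cosh x ^ 2 := by
    rw [Real.tanh_eq_sinh_div_cosh]
    field_simp
  rwa [hd, he]

/-- Ultimate bound on the sliding-surface-based error `e(t) = ṡ(t) + c3 tanh((s(t)-s_d)/c4)`
for the P-like controller in a smoothing field, assuming the heading angle stays in
`[-π + ε, -ε]`: `limsup_{t→∞} |e(t)| ≤ (γ3 v + c3 γ2/c4)/(c1 γ1 sin ε)`. -/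
theorem stmt_14 (v c1 c3 c4 γ1 γ2 γ3 ε sd t0 : ℝ)
    (hv : 0 < v) (hc3 : 0 < c3) (hc4 : 0 < c4)
    (hγ1 : 0 < γ1) (hγ2 : 0 < γ2) (hγ3 : 0 < γ3)
    (hε : ε ∈ Set.Ioo 0 (π / 2))
    (hc3' : c3 < v * γ1 * Real.cos ε)
    (hc1 : c1 > γ3 * v / (γ1 * Real.sin ε * (v * γ1 * Real.cos ε - c3)))
    (s s' s'' φ n q : ℝ → ℝ)
    (hds : ∀ t : ℝ, t0 ≤ t → HasDerivAt s (s' t) t)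
    (hdds : ∀ t : ℝ, t0 ≤ t → HasDerivAt s' (s'' t) t)
    (hφ : Continuous φ)
    (hn : ∀ t : ℝ, γ1 ≤ n t ∧ n t ≤ γ2)
    (hq : ∀ t : ℝ, |q t| ≤ γ3)
    (hs' : ∀ t : ℝ, t0 ≤ t → s' t = -v * n t * Real.cos (φ t))
    (hs'' : ∀ t : ℝ, t0 ≤ t →
      s'' t = (c1 * (s' t + c3 * Real.tanh ((s t - sd) / c4))) * v * n t * Real.sin (φ t)
        + v ^ 2 * q t)
    (hφin : ∀ t : ℝ, t0 ≤ t → φ t ∈ Set.Icc (-π + ε) (-ε)) :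
    limsup (fun t => |s' t + c3 * Real.tanh ((s t - sd) / c4)|) atTop ≤
      (γ3 * v + c3 * γ2 / c4) / (c1 * γ1 * Real.sin ε) := by
  obtain ⟨hε0, hε1⟩ := hε
  have hsin : 0 < Real.sin ε := Real.sin_pos_of_pos_of_lt_pi hε0 (by linarith [Real.pi_pos])
  have hd : 0 < v * γ1 * Real.cos ε - c3 := by linarith
  have hc1pos : 0 < c1 := lt_trans (by positivity) hc1
  have ha : 0 < c1 * v * γ1 * Real.sin ε := by positivity
  refine limsup_abs_le_of_mul_deriv_le (t0 := t0) ha (by positivity)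
    (x' := fun t => s'' t + c3 * ((1 - Real.tanh ((s t - sd) / c4) ^ 2) * (s' t / c4)))
    (fun t ht => ?_) (fun t ht => ?_)
  · exact (hdds t ht).add (((hasDerivAt_real_tanh _).comp t
      (((hds t ht).sub_const sd).div_const c4)).const_mul c3)
  · have hab : c1 * v * γ1 * Real.sin ε * ((γ3 * v + c3 * γ2 / c4) / (c1 * γ1 * Real.sin ε))
        = v ^ 2 * γ3 + c3 * (v * γ2 / c4) := by
      field_simp
    rw [hab]
    rw [hs'' t ht]
    set T := Real.tanh ((s t - sd) / c4)
    set e := s' t + c3 * T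
    have hsinφ : Real.sin (φ t) ≤ -Real.sin ε := by
      obtain ⟨h1, h2⟩ := hφin t ht
      rcases le_total (φ t) (-(π / 2)) with h | h
      · have := Real.sin_le_sin_of_le_of_le_pi_div_two (x := ε) (y := φ t + π)
          (by linarith) (by linarith) (by linarith)
        rw [Real.sin_add_pi] at this
        linarith
      · have := Real.sin_le_sin_of_le_of_le_pi_div_two (x := φ t) (y := -ε)
          (by linarith) (by linarith) h2
        rwa [Real.sin_neg] at this
    have hT0 : 0 ≤ 1 - T ^ 2 := by
      linarith [Real.tanh_sq_lt_one ((s t - sd) / c4)]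
    have hs'abs : |s' t| ≤ v * γ2 := by
      have hn0 : 0 ≤ n t := hγ1.le.trans (hn t).1
      rw [hs' t ht, abs_mul, abs_mul, abs_neg, abs_of_pos hv, abs_of_nonneg hn0]
      calc v * n t * |Real.cos (φ t)| ≤ v * n t * 1 := by
            gcongr
            exact Real.abs_cos_le_one _
        _ ≤ v * γ2 := by
            rw [mul_one]
            gcongr
            exact (hn t).2
    have hdamp : n t * Real.sin (φ t) ≤ -(γ1 * Real.sin ε) := by
      nlinarith [(hn t).1]
    have hdamp' := mul_le_mul_of_nonneg_left hdamp (by positivity : 0 ≤ c1 * v * e ^ 2)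
    have hpert : |v ^ 2 * q t + c3 * ((1 - T ^ 2) * (s' t / c4))|
        ≤ v ^ 2 * γ3 + c3 * (v * γ2 / c4) := by
      refine (abs_add_le _ _).trans (add_le_add ?_ ?_)
      · rw [abs_mul, abs_of_pos (by positivity : 0 < v ^ 2)]
        gcongr
        exact hq t
      · rw [abs_mul, abs_mul, abs_div, abs_of_pos hc3, abs_of_nonneg hT0, abs_of_pos hc4]
        gcongr
        calc (1 - T ^ 2) * (|s' t| / c4) ≤ 1 * (|s' t| / c4) := by
              gcongr
              linarith [sq_nonneg T]
          _ ≤ v * γ2 / c4 := by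
              rw [one_mul]
              gcongr
    have hcross := le_abs_self (e * (v ^ 2 * q t + c3 * ((1 - T ^ 2) * (s' t / c4))))
    rw [abs_mul] at hcross
    have hcross' := mul_le_mul_of_nonneg_left hpert (abs_nonneg e)
    linarith
end

section
/- Fix constants c3, c4 > 0 and t0 ∈ ℝ, and let ε : [t0, ∞) → ℝ be a differentiable function satisfying ε̇(t) = -c3·tanh(ε(t)/c4) for all t ≥ t0. Then ε(t) → 0 as t → ∞, and there exist constants C > 0 and ρ > 0 such that |ε(t)| ≤ C·exp(-ρ(t - t0)) for all t ≥ t0. -/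
open Real Filter

/-- A function satisfying `f' = -k f` on `[a, ∞)` is a decaying exponential there. -/
theorem eq_mul_exp_of_hasDerivAt_neg_mul {f : ℝ → ℝ} {k a : ℝ}
    (hf : ∀ t, a ≤ t → HasDerivAt f (-k * f t) t) {t : ℝ} (ht : a ≤ t) :
    f t = f a * Real.exp (-k * (t - a)) := by
  have hg : ∀ s, a ≤ s → HasDerivAt (fun s => f s * Real.exp (k * (s - a))) 0 s := by
    intro s hs
    have he : HasDerivAt (fun s => Real.exp (k * (s - a))) (Real.exp (k * (s - a)) * k) s := by
      simpa using (((hasDerivAt_id s).sub_const a).const_mul k).exp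
    exact ((hf s hs).mul he).congr_deriv (by ring)
  have hconst := constant_of_has_deriv_right_zero
    (fun s hs => (hg s hs.1).continuousAt.continuousWithinAt)
    (fun s hs => (hg s hs.1).hasDerivWithinAt) t ⟨ht, le_rfl⟩
  simp only [sub_self, mul_zero, Real.exp_zero, mul_one] at hconst
  rw [← hconst, mul_assoc, ← Real.exp_add]
  simp

/-- The sinh substitution turns `ε' = -c₃ tanh (ε / c₄)` into a linear equation. -/
theorem hasDerivAt_sinh_div {ε : ℝ → ℝ} {c3 c4 t : ℝ}
    (h : HasDerivAt ε (-c3 * Real.tanh (ε t / c4)) t) :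
    HasDerivAt (fun s => Real.sinh (ε s / c4)) (-(c3 / c4) * Real.sinh (ε t / c4)) t := by
  convert (h.div_const c4).sinh using 1
  rw [Real.tanh_eq_sinh_div_cosh]
  have := (Real.cosh_pos (ε t / c4)).ne'
  field_simp

theorem abs_le_abs_sinh (x : ℝ) : |x| ≤ |Real.sinh x| := by
  rw [Real.abs_sinh]
  exact Real.self_le_sinh_iff.2 (abs_nonneg x)

/-- The sliding-surface dynamics `ε̇ = -c3 tanh(ε/c4)` drive the tracking error to
zero with exponential convergence speed. -/
theorem stmt_15 (c3 c4 t0 : ℝ) (hc3 : 0 < c3) (hc4 : 0 < c4)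
    (ε : ℝ → ℝ)
    (hε : ∀ t : ℝ, t0 ≤ t → HasDerivAt ε (-c3 * Real.tanh (ε t / c4)) t) :
    Tendsto ε atTop (nhds 0) ∧
    ∃ C > (0 : ℝ), ∃ ρ > (0 : ℝ), ∀ t : ℝ, t0 ≤ t →
      |ε t| ≤ C * Real.exp (-ρ * (t - t0)) := by
  have hρ : 0 < c3 / c4 := div_pos hc3 hc4
  have hbound : ∀ t, t0 ≤ t →
      |ε t| ≤ c4 * (|Real.sinh (ε t0 / c4)| + 1) * Real.exp (-(c3 / c4) * (t - t0)) := by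
    intro t ht
    have hsol := eq_mul_exp_of_hasDerivAt_neg_mul
      (fun s hs => hasDerivAt_sinh_div (hε s hs)) ht
    have hle := abs_le_abs_sinh (ε t / c4)
    rw [hsol, abs_mul, Real.abs_exp, abs_div, abs_of_pos hc4, div_le_iff₀' hc4] at hle
    refine hle.trans ?_
    rw [mul_assoc]
    gcongr
    linarith
  refine ⟨?_, _, by positivity, _, hρ, hbound⟩
  refine squeeze_zero_norm' ((eventually_ge_atTop t0).mono hbound) ?_
  have hexp : Tendsto (fun t => Real.exp (-(c3 / c4) * (t - t0))) atTop (nhds 0) :=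
    Real.tendsto_exp_atBot.comp
      ((tendsto_atTop_add_const_right _ (-t0) tendsto_id).const_mul_atTop_of_neg
        (neg_lt_zero.2 hρ))
  simpa using hexp.const_mul (c4 * (|Real.sinh (ε t0 / c4)| + 1))
end
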